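/- arXiv:2010.08035 — 8 statements merged into one kernel-verified Lean document; each statement's English description precedes it below -/
import Mathlib

section
/- The set Ŝ of partial bijections of X locally determined by S is itself closed under composition and under taking inverses of functions (hence is an inverse semigroup). Moreover, if X can be expressed as a finite disjoint union of domains, then the set Γ_S of bijections of X that are locally determined by S is a group under composition: it contains the identity of X and is closed under composition and inversion. -/
set_option autoImplicit false

namespace GTLD

/-- A partial bijection of `X`: a functional, injective relation on `X`.
It represents a bijection between its domain and its image. -/
structure PartialBij (X : Type*) where
  rel : X → X → Prop
  functional : ∀ ⦃x y y'⦄, rel x y → rel x y' → y = y'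
  injective : ∀ ⦃x x' y⦄, rel x y → rel x' y → x = x'

namespace PartialBij

variable {X : Type*}

/-- The domain of a partial bijection. -/
def domSet (f : PartialBij X) : Set X :=
  {x | ∃ y, f.rel x y}

/-- The image of a partial bijection. -/
def imgSet (f : PartialBij X) : Set X :=
  {y | ∃ x, f.rel x y}

/-- The image of a set under a partial bijection. -/
def image (f : PartialBij X) (A : Set X) : Set X :=
  {y | ∃ x ∈ A, f.rel x y}

/-- Composition `g ∘ f` of partial bijections (first apply `f`, then `g`);
this is the composition `g ∘ f : f⁻¹(B ∩ C) → g(B ∩ C)` of the paper. -/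
def comp (g f : PartialBij X) : PartialBij X where
  rel := fun x z => ∃ y, f.rel x y ∧ g.rel y z
  functional := by
    rintro x z z' ⟨y, h1, h2⟩ ⟨y', h1', h2'⟩
    cases f.functional h1 h1'
    exact g.functional h2 h2'
  injective := by
    rintro x x' z ⟨y, h1, h2⟩ ⟨y', h1', h2'⟩
    cases g.injective h2 h2'
    exact f.injective h1 h1'

/-- The inverse of a partial bijection. -/
def inv (f : PartialBij X) : PartialBij X where
  rel := fun x y => f.rel y x
  functional := by
    intro x y y' h h'
    exact f.injective h h'
  injective := by
    intro x x' y h h'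
    exact f.functional h h'

/-- The restriction of a partial bijection to a subset. -/
def restrict (f : PartialBij X) (A : Set X) : PartialBij X where
  rel := fun x y => x ∈ A ∧ f.rel x y
  functional := by
    rintro x y y' ⟨_, h⟩ ⟨_, h'⟩
    exact f.functional h h'
  injective := by
    rintro x x' y ⟨_, h⟩ ⟨_, h'⟩
    exact f.injective h h'

/-- The identity partial bijection on a subset `A ⊆ X`. -/
def idOn (A : Set X) : PartialBij X where
  rel := fun x y => x ∈ A ∧ x = y
  functional := by
    rintro x y y' ⟨_, h1⟩ ⟨_, h2⟩
    rw [← h1, ← h2]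
  injective := by
    rintro x x' y ⟨_, h1⟩ ⟨_, h2⟩
    rw [h1, h2]

end PartialBij

variable {X : Type*}

/-- `D` is a domain for `S`: it is the domain of some element of `S`. -/
def IsDomain (S : Set (PartialBij X)) (D : Set X) : Prop :=
  ∃ s ∈ S, s.domSet = D

/-- `Y` is a finite disjoint union of domains. -/
def FinDisjUnionOfDomains (S : Set (PartialBij X)) (Y : Set X) : Prop :=
  ∃ (n : ℕ) (D : Fin n → Set X), (∀ i, IsDomain S (D i)) ∧
    (∀ i j, i ≠ j → D i ∩ D j = ∅) ∧ (⋃ i, D i) = Y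

/-- A partial bijection is locally determined by `S`: its domain and image admit
finite partitions into domains such that the restriction of the bijection to each
member of the first partition is an element of `S` mapping it bijectively onto the
corresponding member of the second. -/
def LocallyDetermined (S : Set (PartialBij X)) (f : PartialBij X) : Prop :=
  ∃ (m : ℕ) (t : Fin m → PartialBij X),
    (∀ i, t i ∈ S) ∧
    (∀ i j, i ≠ j → (t i).domSet ∩ (t j).domSet = ∅) ∧
    (∀ i j, i ≠ j → (t i).imgSet ∩ (t j).imgSet = ∅) ∧
    (⋃ i, (t i).domSet) = f.domSet ∧
    (∀ x y, f.rel x y ↔ ∃ i, (t i).rel x y)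

/-- Membership in the group `Γ_S`: a bijection of all of `X` that is
locally determined by `S`. -/
def MemGamma (S : Set (PartialBij X)) (γ : PartialBij X) : Prop :=
  γ.domSet = Set.univ ∧ γ.imgSet = Set.univ ∧ LocallyDetermined S γ

/-- `Pt` is a partition of `D` (into nonempty pieces). -/
def IsPartitionOf (Pt : Set (Set X)) (D : Set X) : Prop :=
  ∅ ∉ Pt ∧ ⋃₀ Pt = D ∧ ∀ P ∈ Pt, ∀ Q ∈ Pt, P ≠ Q → P ∩ Q = ∅

/-- The set of domains of `S` has the compact ultrametric property:
intersecting domains are nested, and the complement of a domain is a finite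
union of domains. -/
def CompactUltrametric (S : Set (PartialBij X)) : Prop :=
  (∀ D₁ D₂, IsDomain S D₁ → IsDomain S D₂ → (D₁ ∩ D₂).Nonempty →
    D₁ ⊆ D₂ ∨ D₂ ⊆ D₁) ∧
  (∀ D, IsDomain S D → ∃ (n : ℕ) (E : Fin n → Set X),
    (∀ i, IsDomain S (E i)) ∧ (⋃ i, E i) = Dᶜ)

/-- `F` is the greatest proper nonempty subdomain of `D` containing `x`. -/
def IsGreatestProperSub (S : Set (PartialBij X)) (D F : Set X) (x : X) : Prop :=
  IsDomain S F ∧ x ∈ F ∧ F ⊂ D ∧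
    ∀ F', IsDomain S F' → x ∈ F' → F' ⊂ D → F' ⊆ F

/-- `maxPart` assigns to each nonempty domain its maximal partition: the partition
into greatest proper nonempty subdomains, or `{D}` if `D` has no proper nonempty
subdomain. -/
def MaxPartSpec (S : Set (PartialBij X)) (maxPart : Set X → Set (Set X)) : Prop :=
  ∀ D, IsDomain S D → D.Nonempty →
    ((∃ F, IsDomain S F ∧ F.Nonempty ∧ F ⊂ D) →
      maxPart D = {F | ∃ x ∈ D, IsGreatestProperSub S D F x}) ∧
    ((¬ ∃ F, IsDomain S F ∧ F.Nonempty ∧ F ⊂ D) → maxPart D = {D})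

/-- An `S`-structure: a structure function `str` assigning structure sets to pairs
of nonempty domains, and a pattern function `pat` assigning sets of patterns
(finite partitions into domains) to nonempty domains, subject to the axioms
(P1)-(P5) and (S1)-(S6). -/
structure SStructure (S : Set (PartialBij X)) where
  str : Set X → Set X → Set (PartialBij X)
  pat : Set X → Set (Set (Set X))
  /-- (P1) the trivial partition is a pattern -/
  pat_trivial : ∀ D, IsDomain S D → D.Nonempty → {D} ∈ pat D
  /-- (P2) each pattern is a finite partition of `D` into domains -/
  pat_partition : ∀ D, IsDomain S D → D.Nonempty → ∀ Pt ∈ pat D,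
    Pt.Finite ∧ IsPartitionOf Pt D ∧ ∀ P ∈ Pt, IsDomain S P
  /-- (P3) restriction -/
  pat_restrict : ∀ D E, IsDomain S D → D.Nonempty → IsDomain S E → E.Nonempty →
    E ⊆ D → ∀ Pt ∈ pat D, {Q | ∃ P ∈ Pt, (P ∩ E).Nonempty ∧ Q = P ∩ E} ∈ pat E
  /-- (P4) patchwork -/
  pat_patchwork : ∀ D, IsDomain S D → D.Nonempty → ∀ Pt ∈ pat D,
    ∀ F : Set X → Set (Set X), (∀ P ∈ Pt, F P ∈ pat P) →
    {Q | ∃ P ∈ Pt, Q ∈ F P} ∈ pat D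
  /-- (P5) cofinality -/
  pat_cofinal : ∀ D, IsDomain S D → D.Nonempty →
    ∀ Pt' : Set (Set X), Pt'.Finite → IsPartitionOf Pt' D →
    (∀ P ∈ Pt', IsDomain S P) →
    ∃ Pt ∈ pat D, ∀ P ∈ Pt, ∃ P' ∈ Pt', P ⊆ P'
  /-- (S1) elements of `str D₁ D₂` lie in `S`, with domain `D₁` and image `D₂` -/
  str_mem : ∀ D₁ D₂, ∀ s ∈ str D₁ D₂, s ∈ S ∧ s.domSet = D₁ ∧ s.imgSet = D₂
  /-- (S2) identities -/
  str_id : ∀ D, IsDomain S D → D.Nonempty → PartialBij.idOn D ∈ str D D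
  /-- (S3) inverses -/
  str_inv : ∀ D₁ D₂, ∀ s ∈ str D₁ D₂, PartialBij.inv s ∈ str D₂ D₁
  /-- (S4) compositions -/
  str_comp : ∀ D₁ D₂ D₃, ∀ s₁ ∈ str D₁ D₂, ∀ s₂ ∈ str D₂ D₃,
    PartialBij.comp s₂ s₁ ∈ str D₁ D₃
  /-- (S5) generation -/
  generation : ∀ f : PartialBij X, IsDomain S f.domSet → f.domSet.Nonempty →
    LocallyDetermined S f →
    ∃ Pt ∈ pat f.domSet, ∀ E ∈ Pt,
      f.restrict E ∈ S ∧ f.restrict E ∈ str E (f.image E)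
  /-- (S6) `𝕊`-invariance of `ℙ` -/
  pat_invariant : ∀ D₁ D₂, IsDomain S D₁ → D₁.Nonempty → ∀ Pt ∈ pat D₁,
    ∀ s ∈ str D₁ D₂, {Q | ∃ P ∈ Pt, Q = PartialBij.image s P} ∈ pat D₂

/-- The maximal `S`-structure: the structure sets are all elements of `S` with the
given domain and image, and the patterns are all finite partitions into domains. -/
def IsMaximalSStructure {S : Set (PartialBij X)} (SS : SStructure S) : Prop :=
  (∀ D₁ D₂, IsDomain S D₁ → D₁.Nonempty → IsDomain S D₂ → D₂.Nonempty →
    SS.str D₁ D₂ = {s | s ∈ S ∧ s.domSet = D₁ ∧ s.imgSet = D₂}) ∧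
  (∀ D, IsDomain S D → D.Nonempty →
    SS.pat D = {Pt | Pt.Finite ∧ IsPartitionOf Pt D ∧ ∀ P ∈ Pt, IsDomain S P})

/-- `f` is (a representative of) an element `[f, D]` of `ℬ`: its domain is a
nonempty domain and it is locally determined by `S`. -/
def IsSPair (S : Set (PartialBij X)) (f : PartialBij X) : Prop :=
  IsDomain S f.domSet ∧ f.domSet.Nonempty ∧ LocallyDetermined S f

/-- The fundamental equivalence relation on pairs: `(f, D₁) ∼ (g, D₂)` iff
`f = g ∘ h` for some `h ∈ 𝕊(D₁, D₂)`. -/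
def PairRel {S : Set (PartialBij X)} (SS : SStructure S) (f g : PartialBij X) : Prop :=
  ∃ h ∈ SS.str f.domSet g.domSet, f = PartialBij.comp g h

/-- A pseudovertex: a nonempty finite set of (representatives of) elements of `ℬ`
whose images are pairwise disjoint. -/
def IsPseudovertex (S : Set (PartialBij X)) (v : Set (PartialBij X)) : Prop :=
  v.Finite ∧ v.Nonempty ∧ (∀ f ∈ v, IsSPair S f) ∧
    ∀ f ∈ v, ∀ g ∈ v, f ≠ g → f.imgSet ∩ g.imgSet = ∅

/-- The image of a pseudovertex. -/
def PVImage (v : Set (PartialBij X)) : Set X :=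
  ⋃ f ∈ v, f.imgSet

/-- Two (representative sets of) pseudovertices are equal as sets of equivalence
classes. -/
def PVEquiv {S : Set (PartialBij X)} (SS : SStructure S)
    (v w : Set (PartialBij X)) : Prop :=
  (∀ f ∈ v, ∃ g ∈ w, PairRel SS f g) ∧ (∀ g ∈ w, ∃ f ∈ v, PairRel SS f g)

/-- An expansion of a pseudovertex `v` at an element `f ∈ v`: replace `f` by the
pieces `(f ∘ h)|_E` for `E` in a nontrivial pattern `Pt` of a domain `D̂`, where
`h ∈ 𝕊(D̂, dom f)`. -/
def Expansion {S : Set (PartialBij X)} (SS : SStructure S)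
    (v v' : Set (PartialBij X)) : Prop :=
  ∃ f ∈ v, ∃ (Dh : Set X) (h : PartialBij X) (Pt : Set (Set X)),
    h ∈ SS.str Dh f.domSet ∧ Pt ∈ SS.pat Dh ∧
    (∃ P ∈ Pt, ∃ Q ∈ Pt, P ≠ Q) ∧
    v' = (v \ {f}) ∪ {g | ∃ E ∈ Pt, g = (PartialBij.comp f h).restrict E}

/-- The partial order on pseudovertices induced by expansion (at the level of
sets of equivalence classes): `v ≤ w` iff a finite (possibly empty) sequence of
expansions leads from `v` to a pseudovertex equal to `w` as a set of classes. -/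
def PVLE {S : Set (PartialBij X)} (SS : SStructure S)
    (v w : Set (PartialBij X)) : Prop :=
  ∃ w', Relation.ReflTransGen (Expansion SS) v w' ∧ PVEquiv SS w' w

/-- Strict version of `PVLE`. -/
def PVLT {S : Set (PartialBij X)} (SS : SStructure S)
    (v w : Set (PartialBij X)) : Prop :=
  PVLE SS v w ∧ ¬ PVEquiv SS v w

/-- The action of a partial bijection `s` on a pseudovertex:
`s · {[f₁,D₁],…,[fₘ,Dₘ]} = {[s∘f₁,D₁],…,[s∘fₘ,Dₘ]}`. -/
def PVAct (s : PartialBij X) (v : Set (PartialBij X)) : Set (PartialBij X) :=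
  (fun f => PartialBij.comp s f) '' v

/-- Two pseudovertices have the same type: there is a bijection between them
matching domains of the same domain type. -/
def SameType {S : Set (PartialBij X)} (SS : SStructure S)
    (v w : Set (PartialBij X)) : Prop :=
  ∃ φ : PartialBij X → PartialBij X, Set.BijOn φ v w ∧
    ∀ f ∈ v, (SS.str f.domSet (φ f).domSet).Nonempty

/-- The stabilizer of a pseudovertex `v` in `Γ_S`. -/
def PVStab {S : Set (PartialBij X)} (SS : SStructure S)
    (v : Set (PartialBij X)) : Set (PartialBij X) :=
  {γ | MemGamma S γ ∧ PVEquiv SS (PVAct γ v) v}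

/-- The subgroup of the stabilizer fixing each class `[f, D] ∈ v`. -/
def PVStabFix {S : Set (PartialBij X)} (SS : SStructure S)
    (v : Set (PartialBij X)) : Set (PartialBij X) :=
  {γ | MemGamma S γ ∧ ∀ f ∈ v, PairRel SS (PartialBij.comp γ f) f}

/-- `Pt₁ ⪯ Pt₂`: the partition `Pt₂` is obtained from `Pt₁` by replacing each
member `D` of `Pt₁` by a pattern of `D`. -/
def PatRefines {S : Set (PartialBij X)} (SS : SStructure S)
    (Pt₁ Pt₂ : Set (Set X)) : Prop :=
  ∃ F : Set X → Set (Set X), (∀ D ∈ Pt₁, F D ∈ SS.pat D) ∧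
    Pt₂ = {Q | ∃ D ∈ Pt₁, Q ∈ F D}

/-- A simple expansion: an expansion using the maximal partition. -/
def SimpleExpansion {S : Set (PartialBij X)} (SS : SStructure S)
    (maxPart : Set X → Set (Set X)) (v v' : Set (PartialBij X)) : Prop :=
  ∃ f ∈ v, ∃ (Dh : Set X) (h : PartialBij X),
    h ∈ SS.str Dh f.domSet ∧
    (∃ P ∈ maxPart Dh, ∃ Q ∈ maxPart Dh, P ≠ Q) ∧
    v' = (v \ {f}) ∪ {g | ∃ E ∈ maxPart Dh, g = (PartialBij.comp f h).restrict E}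

/-- `v'` is the result of `ℰ`-expansion from `v`. -/
def EExpansionFrom (E : PartialBij X → Set (Set (PartialBij X)))
    (v v' : Set (PartialBij X)) : Prop :=
  ∃ F : PartialBij X → Set (PartialBij X),
    (∀ f ∈ v, F f ∈ E f) ∧ v' = ⋃ f ∈ v, F f

/-- `E` is an expansion scheme: conditions (1)-(4) of Definition 6.1. -/
def IsExpansionScheme {S : Set (PartialBij X)} (SS : SStructure S)
    (E : PartialBij X → Set (Set (PartialBij X))) : Prop :=
  ∀ f : PartialBij X, IsSPair S f →
    (∀ w ∈ E f, IsPseudovertex S w ∧ PVLE SS {f} w) ∧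
    ({f} ∈ E f) ∧
    (∀ s : PartialBij X, LocallyDetermined S s → f.imgSet ⊆ s.domSet →
      (∀ w ∈ E f, ∃ w' ∈ E (PartialBij.comp s f), PVEquiv SS (PVAct s w) w') ∧
      (∀ w' ∈ E (PartialBij.comp s f), ∃ w ∈ E f, PVEquiv SS (PVAct s w) w')) ∧
    (∀ w₁ ∈ E f, ∀ w₂ ∈ E f, PVLE SS w₁ w₂ → EExpansionFrom E w₁ w₂)

/-- An `ℰ`-chain: a strictly increasing sequence of pseudovertices, each of which
is the result of `ℰ`-expansion from the first. -/
def IsEChain {S : Set (PartialBij X)} (SS : SStructure S)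
    (E : PartialBij X → Set (Set (PartialBij X)))
    (m : ℕ) (c : Fin (m + 1) → Set (PartialBij X)) : Prop :=
  (∀ i, IsPseudovertex S (c i)) ∧
  (∀ i j : Fin (m + 1), i < j → PVLT SS (c i) (c j)) ∧
  (∀ i, EExpansionFrom E (c 0) (c i))

end GTLD

namespace GTLD

/-- Elementwise criterion for local determination, with an arbitrary finite index type. -/
theorem locallyDetermined_of {X : Type*} {S : Set (PartialBij X)} {f : PartialBij X}
    {ι : Type} [Fintype ι] (t : ι → PartialBij X) (hS : ∀ i, t i ∈ S)
    (hd : ∀ i j x y z, (t i).rel x y → (t j).rel x z → i = j)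
    (hi : ∀ i j x y z, (t i).rel x z → (t j).rel y z → i = j)
    (hf : ∀ x y, f.rel x y ↔ ∃ i, (t i).rel x y) : LocallyDetermined S f := by
  let e := (Fintype.equivFin ι).symm
  refine ⟨Fintype.card ι, fun k => t (e k), fun k => hS _, ?_, ?_, ?_, ?_⟩
  · intro i j hij
    ext x
    simp only [Set.mem_inter_iff, Set.mem_empty_iff_false, iff_false]
    rintro ⟨⟨y, hy⟩, ⟨z, hz⟩⟩
    exact hij (e.injective (hd _ _ _ _ _ hy hz))
  · intro i j hij
    ext x
    simp only [Set.mem_inter_iff, Set.mem_empty_iff_false, iff_false]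
    rintro ⟨⟨y, hy⟩, ⟨z, hz⟩⟩
    exact hij (e.injective (hi _ _ _ _ _ hy hz))
  · ext x
    simp only [Set.mem_iUnion]
    constructor
    · rintro ⟨i, y, hy⟩
      exact ⟨y, (hf x y).2 ⟨_, hy⟩⟩
    · rintro ⟨y, hy⟩
      obtain ⟨i, h⟩ := (hf x y).1 hy
      exact ⟨e.symm i, y, by simpa using h⟩
  · intro x y
    rw [hf]
    exact (e.surjective.exists (p := fun i => (t i).rel x y))

/-- Elementwise form of local determination. -/
theorem LocallyDetermined.elim {X : Type*} {S : Set (PartialBij X)} {f : PartialBij X}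
    (h : LocallyDetermined S f) : ∃ (m : ℕ) (t : Fin m → PartialBij X), (∀ i, t i ∈ S) ∧
    (∀ i j x y z, (t i).rel x y → (t j).rel x z → i = j) ∧
    (∀ i j x y z, (t i).rel x z → (t j).rel y z → i = j) ∧
    (∀ x y, f.rel x y ↔ ∃ i, (t i).rel x y) := by
  obtain ⟨m, t, hS, hd, hi, -, hf⟩ := h
  refine ⟨m, t, hS, ?_, ?_, hf⟩
  · intro i j x y z h1 h2
    by_contra hij
    exact (Set.ext_iff.1 (hd i j hij) x).1 ⟨⟨_, h1⟩, ⟨_, h2⟩⟩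
  · intro i j x y z h1 h2
    by_contra hij
    exact (Set.ext_iff.1 (hi i j hij) z).1 ⟨⟨_, h1⟩, ⟨_, h2⟩⟩

/-- `Ŝ`, the set of partial bijections locally determined by `S`, is
closed under composition and inverses; and if `X` is a finite disjoint union of
domains, then `Γ_S` is a group under composition: it contains the identity of `X`
and is closed under composition and inversion. -/
theorem statement3 {X : Type*} (S : Set (PartialBij X))
    (hcomp : ∀ f ∈ S, ∀ g ∈ S, PartialBij.comp g f ∈ S)
    (hinv : ∀ f ∈ S, PartialBij.inv f ∈ S) :
    (∀ f g : PartialBij X, LocallyDetermined S f → LocallyDetermined S g →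
      LocallyDetermined S (PartialBij.comp g f)) ∧
    (∀ f : PartialBij X, LocallyDetermined S f →
      LocallyDetermined S (PartialBij.inv f)) ∧
    (FinDisjUnionOfDomains S Set.univ →
      MemGamma S (PartialBij.idOn Set.univ) ∧
      (∀ γ δ : PartialBij X, MemGamma S γ → MemGamma S δ →
        MemGamma S (PartialBij.comp γ δ)) ∧
      (∀ γ : PartialBij X, MemGamma S γ → MemGamma S (PartialBij.inv γ))) := by
  have C : ∀ f g : PartialBij X, LocallyDetermined S f → LocallyDetermined S g →
      LocallyDetermined S (PartialBij.comp g f) := by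
    intro f g hf hg
    obtain ⟨m, t, tS, td, ti, tf⟩ := hf.elim
    obtain ⟨n, u, uS, ud, ui, uf⟩ := hg.elim
    refine locallyDetermined_of (ι := Fin m × Fin n)
      (fun p => PartialBij.comp (u p.2) (t p.1)) (fun p => hcomp _ (tS _) _ (uS _)) ?_ ?_ ?_
    · rintro ⟨i, j⟩ ⟨i', j'⟩ x y z ⟨a, h1, h2⟩ ⟨b, h3, h4⟩
      obtain rfl := td _ _ _ _ _ h1 h3
      obtain rfl := (t i).functional h1 h3
      obtain rfl := ud _ _ _ _ _ h2 h4
      rfl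
    · rintro ⟨i, j⟩ ⟨i', j'⟩ x y z ⟨a, h1, h2⟩ ⟨b, h3, h4⟩
      obtain rfl := ui _ _ _ _ _ h2 h4
      obtain rfl := (u j).injective h2 h4
      obtain rfl := ti _ _ _ _ _ h1 h3
      rfl
    · intro x z
      constructor
      · rintro ⟨y, h1, h2⟩
        obtain ⟨i, hi⟩ := (tf _ _).1 h1
        obtain ⟨j, hj⟩ := (uf _ _).1 h2
        exact ⟨(i, j), y, hi, hj⟩
      · rintro ⟨⟨i, j⟩, y, h1, h2⟩
        exact ⟨y, (tf _ _).2 ⟨i, h1⟩, (uf _ _).2 ⟨j, h2⟩⟩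
  have I : ∀ f : PartialBij X, LocallyDetermined S f →
      LocallyDetermined S (PartialBij.inv f) := by
    intro f hf
    obtain ⟨m, t, tS, td, ti, tf⟩ := hf.elim
    exact locallyDetermined_of (fun i => PartialBij.inv (t i)) (fun i => hinv _ (tS i))
      (fun i j x y z h1 h2 => ti i j y z x h1 h2)
      (fun i j x y z h1 h2 => td i j z x y h1 h2) (fun x y => tf y x)
  refine ⟨C, I, ?_⟩
  rintro ⟨n, D, hD, hdis, hU⟩
  refine ⟨⟨?_, ?_, ?_⟩, ?_, ?_⟩
  · exact Set.eq_univ_of_forall fun x => ⟨x, trivial, rfl⟩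
  · exact Set.eq_univ_of_forall fun x => ⟨x, trivial, rfl⟩
  · choose s hs hsD using hD
    have key : ∀ i j x, x ∈ D i → x ∈ D j → i = j := by
      intro i j x h1 h2
      by_contra hij
      exact (Set.ext_iff.1 (hdis i j hij) x).1 ⟨h1, h2⟩
    have hr : ∀ i x y, (PartialBij.comp (PartialBij.inv (s i)) (s i)).rel x y ↔
        x ∈ D i ∧ x = y := by
      intro i x y
      rw [← hsD i]
      constructor
      · rintro ⟨z, h1, h2⟩
        exact ⟨⟨z, h1⟩, (s i).injective h1 h2⟩
      · rintro ⟨⟨z, h1⟩, rfl⟩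
        exact ⟨z, h1, h1⟩
    refine locallyDetermined_of (fun i => PartialBij.comp (PartialBij.inv (s i)) (s i))
      (fun i => hcomp _ (hs i) _ (hinv _ (hs i))) ?_ ?_ ?_
    · intro i j x y z h1 h2
      exact key i j x ((hr _ _ _).1 h1).1 ((hr _ _ _).1 h2).1
    · intro i j x y z h1 h2
      obtain ⟨a1, e1⟩ := (hr _ _ _).1 h1
      obtain ⟨a2, e2⟩ := (hr _ _ _).1 h2
      exact key i j z (e1 ▸ a1) (e2 ▸ a2)
    · intro x y
      simp only [hr]
      constructor
      · rintro ⟨-, rfl⟩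
        obtain ⟨i, hi⟩ := Set.mem_iUnion.1 (hU.symm ▸ Set.mem_univ x : x ∈ ⋃ i, D i)
        exact ⟨i, hi, rfl⟩
      · rintro ⟨i, -, rfl⟩
        exact ⟨trivial, rfl⟩
  · rintro γ δ ⟨h1, h2, h3⟩ ⟨k1, k2, k3⟩
    refine ⟨?_, ?_, C _ _ k3 h3⟩
    · refine Set.eq_univ_of_forall fun x => ?_
      obtain ⟨y, hy⟩ : x ∈ δ.domSet := k1 ▸ Set.mem_univ x
      obtain ⟨z, hz⟩ : y ∈ γ.domSet := h1 ▸ Set.mem_univ y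
      exact ⟨z, y, hy, hz⟩
    · refine Set.eq_univ_of_forall fun z => ?_
      obtain ⟨y, hy⟩ : z ∈ γ.imgSet := h2 ▸ Set.mem_univ z
      obtain ⟨x, hx⟩ : y ∈ δ.imgSet := k2 ▸ Set.mem_univ y
      exact ⟨x, y, hx, hy⟩
  · rintro γ ⟨h1, h2, h3⟩
    exact ⟨h2, h1, I _ h3⟩

end GTLD
end

section
/- Assume 𝒟_S has the compact ultrametric property. Then for every nonempty domain D ∈ 𝒟⁺_S there is a constant m ∈ ℕ such that every strictly ascending chain of domains D = D₁ ⊊ D₂ ⊊ D₃ ⊊ ⋯ ⊊ D_k has length k ≤ m. In particular, there is no infinite strictly ascending chain of domains starting at D. -/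
set_option autoImplicit false

namespace GTLD

/-- If `𝒟_S` has the compact ultrametric property, then for every
nonempty domain `D` there is `m` bounding the length of every strictly ascending
chain of domains starting at `D`. -/
theorem statement4 {X : Type*} (S : Set (PartialBij X))
    (hcomp : ∀ f ∈ S, ∀ g ∈ S, PartialBij.comp g f ∈ S)
    (hinv : ∀ f ∈ S, PartialBij.inv f ∈ S)
    (hcu : CompactUltrametric S)
    (D : Set X) (hD : IsDomain S D) (hne : D.Nonempty) :
    ∃ m : ℕ, ∀ (k : ℕ) (C : Fin (k + 1) → Set X),
      (∀ i, IsDomain S (C i)) → StrictMono C → C 0 = D → k + 1 ≤ m := by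
  obtain ⟨hnest, hcompl⟩ := hcu
  obtain ⟨n, E, hE, hU⟩ := hcompl D hD
  refine ⟨n + 1, ?_⟩
  intro k C hC hmono h0
  have key : ∀ i : Fin k, ∃ j : Fin n, E j ⊆ C i.succ ∧ ¬ E j ⊆ C i.castSucc := by
    intro i
    obtain ⟨x, hx1, hx2⟩ := Set.exists_of_ssubset (hmono (Fin.castSucc_lt_succ (i := i)))
    have hDs : ∀ l, D ⊆ C l := fun l => h0 ▸ hmono.monotone (Fin.zero_le l)
    have hxD : x ∈ Dᶜ := fun h => hx2 (hDs _ h)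
    rw [← hU] at hxD
    obtain ⟨j, hj⟩ := Set.mem_iUnion.1 hxD
    refine ⟨j, ?_, fun h => hx2 (h hj)⟩
    rcases hnest _ _ (hE j) (hC i.succ) ⟨x, hj, hx1⟩ with h | h
    · exact h
    · obtain ⟨d, hd⟩ := hne
      have : d ∈ Dᶜ := hU ▸ Set.mem_iUnion.2 ⟨j, h (hDs _ hd)⟩
      exact absurd hd this
  choose f hf1 hf2 using key
  have hlt : ∀ a b : Fin k, a < b → f a ≠ f b := by
    intro a b hab h
    apply hf2 b
    rw [← h]
    exact (hf1 a).trans (hmono.monotone (by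
      rw [Fin.le_def]; simpa using hab))
  have hinj : Function.Injective f := by
    intro a b h
    by_contra hne'
    rcases lt_or_gt_of_ne hne' with h' | h'
    · exact hlt a b h' h
    · exact hlt b a h' h.symm
  have := Fintype.card_le_of_injective f hinj
  simp at this
  omega

end GTLD
end

section
/- Assume 𝒟_S has the compact ultrametric property and let D ∈ 𝒟⁺_S. Then either (1) D has no proper nonempty subdomain, or (2) for each x ∈ D there is a greatest proper subdomain D_x of D containing x; that is, a proper nonempty subdomain D_x ⊊ D with x ∈ D_x such that every proper nonempty subdomain D' ⊊ D with x ∈ D' satisfies D' ⊆ D_x. -/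
set_option autoImplicit false

namespace GTLD

/-- If `𝒟_S` has the compact ultrametric property and `D` is a
nonempty domain, then either `D` has no proper nonempty subdomain, or for each
`x ∈ D` there is a greatest proper subdomain of `D` containing `x`. -/
theorem statement5 {X : Type*} (S : Set (PartialBij X))
    (hcomp : ∀ f ∈ S, ∀ g ∈ S, PartialBij.comp g f ∈ S)
    (hinv : ∀ f ∈ S, PartialBij.inv f ∈ S)
    (hcu : CompactUltrametric S)
    (D : Set X) (hD : IsDomain S D) (hne : D.Nonempty) :
    (¬ ∃ F : Set X, IsDomain S F ∧ F.Nonempty ∧ F ⊂ D) ∨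
      (∀ x ∈ D, ∃ F : Set X, IsGreatestProperSub S D F x) := by
  obtain ⟨hnest, hcompl⟩ := hcu
  by_cases hF : ∃ F : Set X, IsDomain S F ∧ F.Nonempty ∧ F ⊂ D
  swap
  · exact Or.inl hF
  right
  intro x hx
  obtain ⟨F0, hF0, ⟨z, hz⟩, hF0D⟩ := hF
  have h1 : ∃ F1 : Set X, IsDomain S F1 ∧ x ∈ F1 ∧ F1 ⊂ D := by
    by_cases hxF : x ∈ F0
    · exact ⟨F0, hF0, hxF, hF0D⟩
    · obtain ⟨n, E, hE, hU⟩ := hcompl F0 hF0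
      have hx' : x ∈ ⋃ i, E i := by rw [hU]; exact hxF
      obtain ⟨i, hi⟩ := Set.mem_iUnion.1 hx'
      have hzE : z ∉ E i := by
        intro h
        have h' : z ∈ ⋃ i, E i := Set.mem_iUnion.2 ⟨i, h⟩
        rw [hU] at h'
        exact h' hz
      have hzD : z ∈ D := hF0D.1 hz
      rcases hnest (E i) D (hE i) hD ⟨x, hi, hx⟩ with h | h
      · exact ⟨E i, hE i, hi, h, fun h' => hzE (h' hzD)⟩
      · exact absurd (h hzD) hzE
  obtain ⟨F1, hF1, hxF1, hF1D⟩ := h1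
  obtain ⟨n, E, hE, hU⟩ := hcompl F1 hF1
  let C : Set (Set X) := {F | IsDomain S F ∧ F1 ⊆ F ∧ F ⊂ D}
  have hC : C.Finite := by
    refine (Set.finite_range (fun T : Set (Fin n) => F1 ∪ ⋃ i ∈ T, E i)).subset ?_
    rintro F ⟨hFd, hFF, -⟩
    refine ⟨{i | E i ⊆ F}, ?_⟩
    apply Set.Subset.antisymm
    · refine Set.union_subset hFF ?_
      exact Set.iUnion₂_subset fun i hi => hi
    · intro y hy
      by_cases hy1 : y ∈ F1
      · exact Or.inl hy1
      · have hy' : y ∈ ⋃ i, E i := by rw [hU]; exact hy1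
        obtain ⟨i, hi⟩ := Set.mem_iUnion.1 hy'
        rcases hnest (E i) F (hE i) hFd ⟨y, hi, hy⟩ with h | h
        · exact Or.inr (Set.mem_iUnion₂.2 ⟨i, h, hi⟩)
        · have hx' : x ∈ ⋃ i, E i := Set.mem_iUnion.2 ⟨i, h (hFF hxF1)⟩
          rw [hU] at hx'
          exact absurd hxF1 hx'
  obtain ⟨F, hFC, hmax⟩ := hC.exists_maximal ⟨F1, hF1, subset_rfl, hF1D⟩
  refine ⟨F, hFC.1, hFC.2.1 hxF1, hFC.2.2, ?_⟩
  intro F' hF' hxF' hF'D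
  rcases hnest F' F hF' hFC.1 ⟨x, hxF', hFC.2.1 hxF1⟩ with h | h
  · exact h
  · exact hmax ⟨hF', hFC.2.1.trans h, hF'D⟩ h

end GTLD
end

section
/- Assume 𝒟_S has the compact ultrametric property, let D ∈ 𝒟⁺_S properly contain some nonempty subdomain, and for x ∈ D let D_x denote the greatest proper nonempty subdomain of D containing x. Then the collection 𝒫_D = {D_x : x ∈ D} is a finite partition of D into proper nonempty subdomains of D, and every partition 𝒫' of D into proper nonempty subdomains of D is a refinement of 𝒫_D (i.e., every member of 𝒫' is contained in some member of 𝒫_D). -/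
set_option autoImplicit false

namespace GTLD

/-- the maximal partition `Pt_D = {D_x : x ∈ D}` is a finite partition
of `D` into proper nonempty subdomains, and every partition of `D` into proper
nonempty subdomains refines it. -/
theorem statement6 {X : Type*} (S : Set (PartialBij X))
    (hcomp : ∀ f ∈ S, ∀ g ∈ S, PartialBij.comp g f ∈ S)
    (hinv : ∀ f ∈ S, PartialBij.inv f ∈ S)
    (hcu : CompactUltrametric S)
    (D : Set X) (hD : IsDomain S D) (hne : D.Nonempty)
    (hproper : ∃ F : Set X, IsDomain S F ∧ F.Nonempty ∧ F ⊂ D)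
    (Dx : X → Set X) (hDx : ∀ x ∈ D, IsGreatestProperSub S D (Dx x) x) :
    Set.Finite {E : Set X | ∃ x ∈ D, E = Dx x} ∧
    IsPartitionOf {E : Set X | ∃ x ∈ D, E = Dx x} D ∧
    (∀ E ∈ {E : Set X | ∃ x ∈ D, E = Dx x}, IsDomain S E ∧ E.Nonempty ∧ E ⊂ D) ∧
    (∀ Pt' : Set (Set X), IsPartitionOf Pt' D →
      (∀ P ∈ Pt', IsDomain S P ∧ P ⊂ D) →
      ∀ P ∈ Pt', ∃ E : Set X, (∃ x ∈ D, E = Dx x) ∧ P ⊆ E) := by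
  have heq : ∀ x ∈ D, ∀ y ∈ D, (Dx x ∩ Dx y).Nonempty → Dx x = Dx y := by
    intro x hx y hy h
    obtain ⟨a1, a2, a3, a4⟩ := hDx x hx
    obtain ⟨b1, b2, b3, b4⟩ := hDx y hy
    rcases hcu.1 _ _ a1 b1 h with h' | h'
    · exact h'.antisymm (a4 _ b1 (h' a2) b3)
    · exact (b4 _ a1 (h' b2) a3).antisymm h'
  refine ⟨?_, ⟨?_, ?_, ?_⟩, ?_, ?_⟩
  · obtain ⟨x0, hx0⟩ := hne
    obtain ⟨a1, a2, a3, a4⟩ := hDx x0 hx0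
    obtain ⟨n, E, hE, hU⟩ := hcu.2 _ a1
    have hsub : ∀ i, ∀ y ∈ D, y ∈ E i → E i ⊆ Dx y := by
      intro i y hy hyi
      have hx0i : x0 ∉ E i := by
        intro h
        have h2 : x0 ∈ (Dx x0)ᶜ := hU ▸ Set.mem_iUnion.2 ⟨i, h⟩
        exact h2 a2
      rcases hcu.1 _ _ (hE i) hD ⟨y, hyi, hy⟩ with h | h
      · exact (hDx y hy).2.2.2 _ (hE i) hyi ⟨h, fun h' => hx0i (h' hx0)⟩
      · exact absurd (h hx0) hx0i
    have hfin : (({Dx x0} : Set (Set X)) ∪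
        ⋃ i, {F : Set X | ∃ y ∈ D, y ∈ E i ∧ F = Dx y}).Finite := by
      refine (Set.finite_singleton _).union (Set.finite_iUnion fun i => ?_)
      apply Set.Subsingleton.finite
      rintro _ ⟨y, hy, hyi, rfl⟩ _ ⟨z, hz, hzi, rfl⟩
      exact heq y hy z hz ⟨y, hsub i y hy hyi hyi, hsub i z hz hzi hyi⟩
    refine hfin.subset ?_
    rintro _ ⟨y, hy, rfl⟩
    by_cases h : y ∈ Dx x0
    · left
      exact heq y hy x0 hx0 ⟨y, (hDx y hy).2.1, h⟩
    · right
      have h2 : y ∈ ⋃ i, E i := by rw [hU]; exact h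
      obtain ⟨i, hi⟩ := Set.mem_iUnion.1 h2
      exact Set.mem_iUnion.2 ⟨i, y, hy, hi, rfl⟩
  · rintro ⟨x, hx, h⟩
    have h2 := (hDx x hx).2.1
    rw [← h] at h2
    exact h2
  · ext y
    constructor
    · rintro ⟨_, ⟨x, hx, rfl⟩, hy⟩
      exact (hDx x hx).2.2.1.1 hy
    · intro hy
      exact ⟨_, ⟨y, hy, rfl⟩, (hDx y hy).2.1⟩
  · rintro _ ⟨x, hx, rfl⟩ _ ⟨y, hy, rfl⟩ hne'
    by_contra h
    exact hne' (heq x hx y hy (Set.nonempty_iff_ne_empty.2 h))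
  · rintro _ ⟨x, hx, rfl⟩
    exact ⟨(hDx x hx).1, ⟨x, (hDx x hx).2.1⟩, (hDx x hx).2.2.1⟩
  · intro Pt' hPt hdom P hP
    have hPne : P.Nonempty := by
      rw [Set.nonempty_iff_ne_empty]
      rintro rfl
      exact hPt.1 hP
    obtain ⟨x, hx⟩ := hPne
    obtain ⟨h1, h2⟩ := hdom P hP
    exact ⟨Dx x, ⟨x, h2.1 hx, rfl⟩, (hDx x (h2.1 hx)).2.2.2 P h1 hx h2⟩

end GTLD
end

section
/- Assume 𝒟_S has the compact ultrametric property and let D ∈ 𝒟⁺_S. For every finite partition 𝒫 of D into proper nonempty subdomains of D, there is a finite sequence of partitions {D} = 𝒫₀, 𝒫₁, …, 𝒫_ℓ = 𝒫 of D such that for each i ∈ {0, 1, …, ℓ−1}, 𝒫_{i+1} = (𝒫_i − {D'}) ∪ 𝒫_{D'} for some D' ∈ 𝒫_i, where 𝒫_{D'} denotes the maximal partition of D'. -/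
set_option autoImplicit false

namespace GTLD

/-- Existence of the greatest proper subdomain containing a point. -/
theorem exists_greatest_aux {X : Type*} (S : Set (PartialBij X))
    (hnest : ∀ D₁ D₂, IsDomain S D₁ → IsDomain S D₂ → (D₁ ∩ D₂).Nonempty →
      D₁ ⊆ D₂ ∨ D₂ ⊆ D₁)
    (Pt : Set (Set X)) (hfin : Pt.Finite)
    (hdisj : ∀ P ∈ Pt, ∀ Q ∈ Pt, (P ∩ Q).Nonempty → P = Q)
    (hdom : ∀ P ∈ Pt, IsDomain S P)
    (D P : Set X) (x : X) (hP : P ∈ Pt) (hx : x ∈ P) (hPD : P ⊂ D)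
    (hDU : D ⊆ ⋃₀ Pt) :
    ∃ F, IsGreatestProperSub S D F x := by
  have hf : {F | IsDomain S F ∧ P ⊆ F ∧ F ⊂ D}.Finite := by
    refine (hfin.powerset.image (fun T : Set (Set X) => Set.sUnion T)).subset ?_
    rintro F ⟨hF, hPF, hFD⟩
    refine ⟨{R | R ∈ Pt ∧ R ⊆ F}, fun R hR => hR.1, ?_⟩
    apply Set.Subset.antisymm
    · exact Set.sUnion_subset fun R hR => hR.2
    · intro y hy
      obtain ⟨R, hR, hyR⟩ := hDU (hFD.1 hy)
      refine ⟨R, ⟨hR, ?_⟩, hyR⟩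
      rcases hnest R F (hdom R hR) hF ⟨y, hyR, hy⟩ with h | h
      · exact h
      · have := hdisj P hP R hR ⟨x, hx, h (hPF hx)⟩
        rw [← this]; exact hPF
  obtain ⟨F, hF⟩ := hf.exists_maximal ⟨P, hdom P hP, subset_rfl, hPD⟩
  obtain ⟨⟨hF1, hF2, hF3⟩, hmx⟩ := hF
  refine ⟨F, hF1, hF2 hx, hF3, ?_⟩
  intro F' h1 h2 h3
  rcases hnest F' P h1 (hdom P hP) ⟨x, h2, hx⟩ with h | h
  · exact h.trans hF2
  · rcases hnest F F' hF1 h1 ⟨x, hF2 hx, h2⟩ with h' | h'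
    · exact hmx ⟨h1, h, h3⟩ h'
    · exact h'

/-- Generalized version: start from any coarsening of `Pt`. -/
theorem coarsening_aux {X : Type*} (S : Set (PartialBij X))
    (hnest : ∀ D₁ D₂, IsDomain S D₁ → IsDomain S D₂ → (D₁ ∩ D₂).Nonempty →
      D₁ ⊆ D₂ ∨ D₂ ⊆ D₁)
    (maxPart : Set X → Set (Set X)) (hmax : MaxPartSpec S maxPart)
    (Pt : Set (Set X)) (hfin : Pt.Finite)
    (hdisj : ∀ P ∈ Pt, ∀ Q ∈ Pt, (P ∩ Q).Nonempty → P = Q)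
    (hdom : ∀ P ∈ Pt, IsDomain S P) (hnon : ∀ P ∈ Pt, P.Nonempty) (n : ℕ) :
    ∀ Q₀ : Set (Set X), {T | T ⊆ Pt ∧ ∃ q ∈ Q₀, ⋃₀ T ⊆ q}.ncard = n →
      (∀ q ∈ Q₀, IsDomain S q ∧ q.Nonempty ∧ ∀ P ∈ Pt, (P ∩ q).Nonempty → P ⊆ q) →
      (∀ q ∈ Q₀, ∀ r ∈ Q₀, (q ∩ r).Nonempty → q = r) →
      ⋃₀ Q₀ = ⋃₀ Pt →
      ∃ (ℓ : ℕ) (Q : ℕ → Set (Set X)), Q 0 = Q₀ ∧ Q ℓ = Pt ∧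
        ∀ i < ℓ, ∃ D' ∈ Q i, Q (i + 1) = (Q i \ {D'}) ∪ maxPart D' := by
  induction n using Nat.strong_induction_on with
  | _ n ih =>
  intro Q₀ hn hq hqd hU
  by_cases hall : Q₀ ⊆ Pt
  · refine ⟨0, fun _ => Q₀, rfl, ?_, by simp⟩
    apply Set.Subset.antisymm hall
    intro P hP
    obtain ⟨x, hx⟩ := hnon P hP
    obtain ⟨q, hqQ, hxq⟩ : x ∈ ⋃₀ Q₀ := by rw [hU]; exact ⟨P, hP, hx⟩
    rw [hdisj P hP q (hall hqQ) ⟨x, hx, hxq⟩]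
    exact hqQ
  obtain ⟨E, hE, hEPt⟩ := Set.not_subset.1 hall
  obtain ⟨hEd, hEn, hEP⟩ := hq E hE
  have hEU : E ⊆ ⋃₀ Pt := hU ▸ Set.subset_sUnion_of_mem hE
  have hprop : ∀ P ∈ Pt, (P ∩ E).Nonempty → P ⊂ E := fun P hP h =>
    lt_of_le_of_ne (hEP P hP h) (fun e => hEPt (e ▸ hP))
  have hM : maxPart E = {F | ∃ x ∈ E, IsGreatestProperSub S E F x} := by
    apply (hmax E hEd hEn).1
    obtain ⟨x, hx⟩ := hEn
    obtain ⟨P, hP, hxP⟩ := hEU hx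
    exact ⟨P, hdom P hP, ⟨x, hxP⟩, hprop P hP ⟨x, hxP, hx⟩⟩
  have hsub : ∀ F ∈ maxPart E, F ⊂ E := by
    intro F hF
    rw [hM] at hF
    obtain ⟨x, -, h⟩ := hF
    exact h.2.2.1
  have hlt : {T | T ⊆ Pt ∧ ∃ q ∈ (Q₀ \ {E}) ∪ maxPart E, ⋃₀ T ⊆ q}.ncard < n := by
    rw [← hn]
    refine Set.ncard_lt_ncard ?_ (hfin.powerset.subset fun T hT => hT.1)
    refine (Set.ssubset_iff_of_subset ?_).2 ⟨{P | P ∈ Pt ∧ P ⊆ E},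
      ⟨fun P hP => hP.1, E, hE, Set.sUnion_subset fun P hP => hP.2⟩, ?_⟩
    · rintro T ⟨hT, q, hq' | hq', hTq⟩
      · exact ⟨hT, q, hq'.1, hTq⟩
      · exact ⟨hT, E, hE, hTq.trans (hsub q hq').1⟩
    · rintro ⟨-, q, hq', hTq⟩
      have hEq : E ⊆ q := by
        intro y hy
        obtain ⟨P, hP, hyP⟩ := hEU hy
        exact hTq ⟨P, ⟨hP, hEP P hP ⟨y, hyP, hy⟩⟩, hyP⟩
      rcases hq' with hq' | hq'
      · obtain ⟨x, hx⟩ := hEn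
        exact hq'.2 (hqd q hq'.1 E hE ⟨x, hEq hx, hx⟩)
      · exact (hsub q hq').2 hEq
  suffices hsuf :
      (∀ q ∈ (Q₀ \ {E}) ∪ maxPart E,
        IsDomain S q ∧ q.Nonempty ∧ ∀ P ∈ Pt, (P ∩ q).Nonempty → P ⊆ q) ∧
      (∀ q ∈ (Q₀ \ {E}) ∪ maxPart E, ∀ r ∈ (Q₀ \ {E}) ∪ maxPart E,
        (q ∩ r).Nonempty → q = r) ∧
      ⋃₀ ((Q₀ \ {E}) ∪ maxPart E) = ⋃₀ Pt by
    obtain ⟨l, Q, h0, hl, hs⟩ := ih _ hlt ((Q₀ \ {E}) ∪ maxPart E) rfl hsuf.1 hsuf.2.1 hsuf.2.2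
    refine ⟨l + 1, fun k => Nat.casesOn k Q₀ Q, rfl, hl, ?_⟩
    intro i hi
    cases i with
    | zero => exact ⟨E, hE, h0⟩
    | succ i => exact hs i (by omega)
  refine ⟨?_, ?_, ?_⟩
  · rintro q (hq' | hq')
    · exact hq q hq'.1
    · rw [hM] at hq'
      obtain ⟨x, hx, h1, h2, h3, h4⟩ := hq'
      refine ⟨h1, ⟨x, h2⟩, ?_⟩
      rintro P hP ⟨y, hyP, hyq⟩
      rcases hnest P q (hdom P hP) h1 ⟨y, hyP, hyq⟩ with h | h
      · exact h
      · exact h4 P (hdom P hP) (h h2) (hprop P hP ⟨y, hyP, h3.1 hyq⟩)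
  · have hmix : ∀ q ∈ Q₀ \ {E}, ∀ r ∈ maxPart E, ¬ (q ∩ r).Nonempty := by
      rintro q hq' r hr ⟨y, hyq, hyr⟩
      exact hq'.2 (hqd q hq'.1 E hE ⟨y, hyq, (hsub r hr).1 hyr⟩)
    rintro q (hq' | hq') r (hr | hr) hne
    · exact hqd q hq'.1 r hr.1 hne
    · exact absurd hne (hmix q hq' r hr)
    · exact absurd (Set.inter_comm q r ▸ hne) (hmix r hr q hq')
    · rw [hM] at hq' hr
      obtain ⟨x, hx, h1, h2, h3, h4⟩ := hq'
      obtain ⟨x', hx', h1', h2', h3', h4'⟩ := hr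
      rcases hnest q r h1 h1' hne with h | h
      · exact h.antisymm (h4 r h1' (h h2) h3')
      · exact (h4' q h1 (h h2') h3).antisymm h
  · rw [← hU]
    apply Set.Subset.antisymm
    · rintro y ⟨q, hq' | hq', hy⟩
      · exact ⟨q, hq'.1, hy⟩
      · exact ⟨E, hE, (hsub q hq').1 hy⟩
    · rintro y ⟨q, hq', hy⟩
      by_cases hqE : q = E
      · subst hqE
        obtain ⟨P, hP, hyP⟩ := hEU hy
        obtain ⟨F, hF⟩ := exists_greatest_aux S hnest Pt hfin hdisj hdom q P y hP hyP
          (hprop P hP ⟨y, hyP, hy⟩) hEU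
        refine ⟨F, Or.inr ?_, hF.2.1⟩
        rw [hM]
        exact ⟨y, hy, hF⟩
      · exact ⟨q, Or.inl ⟨hq', hqE⟩, hy⟩

/-- maximal partitions generate all finite partitions: every finite
partition of a nonempty domain `D` into proper nonempty subdomains is reached
from `{D}` by a sequence of steps, each replacing one member by its maximal
partition. -/
theorem statement7 {X : Type*} (S : Set (PartialBij X))
    (hcomp : ∀ f ∈ S, ∀ g ∈ S, PartialBij.comp g f ∈ S)
    (hinv : ∀ f ∈ S, PartialBij.inv f ∈ S)
    (hcu : CompactUltrametric S)
    (maxPart : Set X → Set (Set X)) (hmax : MaxPartSpec S maxPart)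
    (D : Set X) (hD : IsDomain S D) (hne : D.Nonempty)
    (Pt : Set (Set X)) (hfin : Pt.Finite) (hpart : IsPartitionOf Pt D)
    (hdom : ∀ P ∈ Pt, IsDomain S P ∧ P ⊂ D) :
    ∃ (ℓ : ℕ) (Q : ℕ → Set (Set X)), Q 0 = {D} ∧ Q ℓ = Pt ∧
      ∀ i < ℓ, ∃ D' ∈ Q i, Q (i + 1) = (Q i \ {D'}) ∪ maxPart D' := by
  obtain ⟨h1, h2, h3⟩ := hpart
  refine coarsening_aux S hcu.1 maxPart hmax Pt hfin ?_ (fun P hP => (hdom P hP).1) ?_ _ {D} rfl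
    ?_ ?_ ?_
  · intro P hP Q hQ hn
    by_contra hne'
    rw [h3 P hP Q hQ hne'] at hn
    exact Set.not_nonempty_empty hn
  · intro P hP
    rw [Set.nonempty_iff_ne_empty]
    rintro rfl
    exact h1 hP
  · rintro q rfl
    exact ⟨hD, hne, fun P hP _ => (hdom P hP).2.1⟩
  · rintro q rfl r rfl _
    rfl
  · rw [Set.sUnion_singleton, h2]

end GTLD
end

section
/- Assume 𝒟_S has the compact ultrametric property. If s ∈ S and D₁, D₂ ∈ 𝒟⁺_S are the domain and image of s respectively, then s carries the maximal partition of D₁ onto the maximal partition of D₂: {s(E) : E ∈ 𝒫_{D₁}} = 𝒫_{D₂}. -/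
set_option autoImplicit false

namespace GTLD

theorem image_isDomain {X : Type*} {S : Set (PartialBij X)}
    (hcomp : ∀ f ∈ S, ∀ g ∈ S, PartialBij.comp g f ∈ S)
    (hinv : ∀ f ∈ S, PartialBij.inv f ∈ S)
    {s : PartialBij X} (hs : s ∈ S) {F : Set X} (hF : IsDomain S F) :
    IsDomain S (s.image F) := by
  obtain ⟨t, ht, rfl⟩ := hF
  refine ⟨PartialBij.comp t (PartialBij.inv s), hcomp _ (hinv _ hs) _ ht, ?_⟩
  ext y
  constructor
  · rintro ⟨z, x, h1, h2⟩
    exact ⟨x, ⟨z, h2⟩, h1⟩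
  · rintro ⟨x, ⟨z, h2⟩, h1⟩
    exact ⟨z, x, h1, h2⟩

theorem inv_image_image {X : Type*} (s : PartialBij X) {F : Set X} (hF : F ⊆ s.domSet) :
    s.inv.image (s.image F) = F := by
  ext x
  constructor
  · rintro ⟨y, ⟨x', hx', h1⟩, h2⟩
    have h2' : s.rel x y := h2
    rwa [s.injective h2' h1]
  · intro hx
    obtain ⟨y, hy⟩ := hF hx
    exact ⟨y, ⟨x, hx, hy⟩, hy⟩

theorem image_inv_image {X : Type*} (s : PartialBij X) {F : Set X} (hF : F ⊆ s.imgSet) :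
    s.image (s.inv.image F) = F :=
  inv_image_image s.inv hF

theorem image_mono {X : Type*} (s : PartialBij X) {F G : Set X} (h : F ⊆ G) :
    s.image F ⊆ s.image G := by
  rintro y ⟨x, hx, hy⟩
  exact ⟨x, h hx, hy⟩

theorem image_ssubset {X : Type*} (s : PartialBij X) {F : Set X} (h : F ⊂ s.domSet) :
    s.image F ⊂ s.imgSet := by
  refine ⟨?_, ?_⟩
  · rintro y ⟨x, hx, hy⟩
    exact ⟨x, hy⟩
  · intro hsub
    apply h.2
    rintro x ⟨y, hy⟩
    obtain ⟨x', hx', h'⟩ := hsub ⟨x, hy⟩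
    rwa [s.injective hy h']

theorem image_proper {X : Type*} {S : Set (PartialBij X)}
    (hcomp : ∀ f ∈ S, ∀ g ∈ S, PartialBij.comp g f ∈ S)
    (hinv : ∀ f ∈ S, PartialBij.inv f ∈ S)
    {s : PartialBij X} (hs : s ∈ S)
    (h : ∃ F, IsDomain S F ∧ F.Nonempty ∧ F ⊂ s.domSet) :
    ∃ F, IsDomain S F ∧ F.Nonempty ∧ F ⊂ s.imgSet := by
  obtain ⟨F, hF, ⟨x, hx⟩, hlt⟩ := h
  obtain ⟨y, hy⟩ := hlt.1 hx
  exact ⟨s.image F, image_isDomain hcomp hinv hs hF, ⟨y, x, hx, hy⟩, image_ssubset s hlt⟩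

theorem image_maxPart {X : Type*} {S : Set (PartialBij X)}
    (hcomp : ∀ f ∈ S, ∀ g ∈ S, PartialBij.comp g f ∈ S)
    (hinv : ∀ f ∈ S, PartialBij.inv f ∈ S)
    {maxPart : Set X → Set (Set X)} (hmax : MaxPartSpec S maxPart)
    {s : PartialBij X} (hs : s ∈ S)
    (hd : s.domSet.Nonempty) (hi : s.imgSet.Nonempty) {F : Set X}
    (hF : F ∈ maxPart s.domSet) :
    F ⊆ s.domSet ∧ s.image F ∈ maxPart s.imgSet := by
  have hD := hmax s.domSet ⟨s, hs, rfl⟩ hd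
  have hI := hmax s.imgSet ⟨s.inv, hinv s hs, rfl⟩ hi
  by_cases h : ∃ F, IsDomain S F ∧ F.Nonempty ∧ F ⊂ s.domSet
  · rw [hI.1 (image_proper hcomp hinv hs h)]
    rw [hD.1 h] at hF
    obtain ⟨x, ⟨y, hy⟩, hdom, hxF, hlt, hgr⟩ := hF
    refine ⟨hlt.1, y, ⟨x, hy⟩, image_isDomain hcomp hinv hs hdom, ⟨x, hxF, hy⟩,
      image_ssubset s hlt, ?_⟩
    intro F' hF' hyF' hlt'
    rw [← image_inv_image s hlt'.1]
    exact image_mono s (hgr _ (image_isDomain hcomp hinv (hinv s hs) hF') ⟨y, hyF', hy⟩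
      (image_ssubset s.inv hlt'))
  · have h' : ¬ ∃ F, IsDomain S F ∧ F.Nonempty ∧ F ⊂ s.imgSet :=
      fun hh => h (image_proper hcomp hinv (hinv s hs) hh)
    rw [hI.2 h']
    rw [hD.2 h] at hF
    obtain rfl : F = s.domSet := hF
    refine ⟨subset_rfl, ?_⟩
    change s.image s.domSet = s.imgSet
    ext y
    constructor
    · rintro ⟨x, _, hy⟩
      exact ⟨x, hy⟩
    · rintro ⟨x, hy⟩
      exact ⟨x, ⟨y, hy⟩, hy⟩

/-- `S`-invariance of the maximal partition: an element `s ∈ S` with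
nonempty domain and image carries the maximal partition of its domain onto the
maximal partition of its image. -/
theorem statement8 {X : Type*} (S : Set (PartialBij X))
    (hcomp : ∀ f ∈ S, ∀ g ∈ S, PartialBij.comp g f ∈ S)
    (hinv : ∀ f ∈ S, PartialBij.inv f ∈ S)
    (hcu : CompactUltrametric S)
    (maxPart : Set X → Set (Set X)) (hmax : MaxPartSpec S maxPart)
    (s : PartialBij X) (hs : s ∈ S)
    (hd : s.domSet.Nonempty) (hi : s.imgSet.Nonempty) :
    PartialBij.image s '' maxPart s.domSet = maxPart s.imgSet := by
  apply Set.Subset.antisymm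
  · rintro _ ⟨F, hF, rfl⟩
    exact (image_maxPart hcomp hinv hmax hs hd hi hF).2
  · intro G hG
    have h := image_maxPart (s := s.inv) hcomp hinv hmax (hinv s hs) hi hd hG
    exact ⟨s.inv.image G, h.2, image_inv_image s h.1⟩

end GTLD
end

section
/- Fix an S-structure (𝕊, ℙ). If v is a pseudovertex and v ↗ v', then v' is a pseudovertex with im(v') = im(v). Moreover: (1) the expansion relation is well-defined on pseudovertices, i.e., if v = v̂ as sets of equivalence classes and v ↗ v', then v̂ ↗ v'; and (2) the relation ≤ (obtained by taking finite, possibly empty, sequences of expansions) is a partial order on the set 𝒫𝒱_𝕊 of pseudovertices. -/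
set_option autoImplicit false

namespace GTLD

namespace PartialBij

theorem ext_rel {X : Type*} {f g : PartialBij X} (h : ∀ x y, f.rel x y ↔ g.rel x y) : f = g := by
  cases f; cases g
  have : ∀ x y, _ = _ := fun x y => propext (h x y)
  simp only [mk.injEq]
  funext x y
  exact this x y

end PartialBij

section helpers

variable {X : Type*} {S : Set (PartialBij X)}

open PartialBij

theorem comp_assoc' (f g h : PartialBij X) : comp (comp f g) h = comp f (comp g h) := by
  apply ext_rel
  intro x y
  constructor
  · rintro ⟨a, ha, b, hb, hc⟩
    exact ⟨b, ⟨a, ha, hb⟩, hc⟩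
  · rintro ⟨b, ⟨a, ha, hb⟩, hc⟩
    exact ⟨a, ha, b, hb, hc⟩

theorem idOn_mem (hcomp : ∀ f ∈ S, ∀ g ∈ S, PartialBij.comp g f ∈ S)
    (hinv : ∀ f ∈ S, PartialBij.inv f ∈ S) {E : Set X} (hE : IsDomain S E) : idOn E ∈ S := by
  obtain ⟨s, hs, rfl⟩ := hE
  have : idOn s.domSet = comp (inv s) s := by
    apply ext_rel
    intro x y
    constructor
    · rintro ⟨⟨z, hz⟩, rfl⟩
      exact ⟨z, hz, hz⟩
    · rintro ⟨z, hz, hz'⟩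
      exact ⟨⟨z, hz⟩, s.injective hz hz'⟩
  rw [this]
  exact hcomp _ hs _ (hinv _ hs)

theorem pairRel_refl (SS : SStructure S) {f : PartialBij X} (hf : IsSPair S f) :
    PairRel SS f f := by
  refine ⟨idOn f.domSet, SS.str_id _ hf.1 hf.2.1, ?_⟩
  apply ext_rel
  intro x y
  constructor
  · intro h
    exact ⟨x, ⟨⟨y, h⟩, rfl⟩, h⟩
  · rintro ⟨z, ⟨_, rfl⟩, h⟩
    exact h

theorem pairRel_symm (SS : SStructure S) {f g : PartialBij X} (h : PairRel SS f g) :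
    PairRel SS g f := by
  obtain ⟨k, hk, e⟩ := h
  refine ⟨inv k, SS.str_inv _ _ _ hk, ?_⟩
  obtain ⟨-, -, him⟩ := SS.str_mem _ _ _ hk
  have e' : ∀ x y, f.rel x y ↔ ∃ z, k.rel x z ∧ g.rel z y := by
    intro x y
    rw [e]
    rfl
  apply ext_rel
  intro x y
  constructor
  · intro h
    have : x ∈ k.imgSet := by
      rw [him]
      exact ⟨y, h⟩
    obtain ⟨z, hz⟩ := this
    exact ⟨z, hz, (e' _ _).2 ⟨x, hz, h⟩⟩
  · rintro ⟨z, hz, h⟩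
    obtain ⟨w, hw, h⟩ := (e' _ _).1 h
    cases k.functional hw hz
    exact h

theorem pairRel_trans (SS : SStructure S) {f g j : PartialBij X} (h : PairRel SS f g)
    (h' : PairRel SS g j) : PairRel SS f j := by
  obtain ⟨k, hk, e⟩ := h
  obtain ⟨l, hl, e'⟩ := h'
  refine ⟨comp l k, SS.str_comp _ _ _ _ hk _ hl, ?_⟩
  rw [← comp_assoc', ← e', ← e]

theorem pairRel_img_subset (SS : SStructure S) {f g : PartialBij X} (h : PairRel SS f g) :
    f.imgSet ⊆ g.imgSet := by
  obtain ⟨k, hk, e⟩ := h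
  rintro y ⟨x, hx⟩
  rw [e] at hx
  obtain ⟨z, _, hz⟩ := hx
  exact ⟨z, hz⟩

theorem pairRel_img (SS : SStructure S) {f g : PartialBij X} (h : PairRel SS f g) :
    f.imgSet = g.imgSet :=
  (pairRel_img_subset SS h).antisymm (pairRel_img_subset SS (pairRel_symm SS h))

theorem IsSPair.img_nonempty {f : PartialBij X} (hf : IsSPair S f) : f.imgSet.Nonempty := by
  obtain ⟨x, y, h⟩ := hf.2.1
  exact ⟨y, x, h⟩

theorem IsPseudovertex.eq_of_img {v : Set (PartialBij X)} (hv : IsPseudovertex S v)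
    {f g : PartialBij X} (hf : f ∈ v) (hg : g ∈ v) {y : X} (h1 : y ∈ f.imgSet)
    (h2 : y ∈ g.imgSet) : f = g := by
  by_contra hne
  have := hv.2.2.2 f hf g hg hne
  exact (this ▸ (⟨h1, h2⟩ : y ∈ f.imgSet ∩ g.imgSet) : y ∈ (∅ : Set X))

theorem IsPseudovertex.eq_of_img_eq {v : Set (PartialBij X)} (hv : IsPseudovertex S v)
    {f g : PartialBij X} (hf : f ∈ v) (hg : g ∈ v) (h : f.imgSet = g.imgSet) : f = g := by
  obtain ⟨y, hy⟩ := (hv.2.2.1 f hf).img_nonempty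
  exact hv.eq_of_img hf hg hy (h ▸ hy)

theorem pvEquiv_refl (SS : SStructure S) {v : Set (PartialBij X)} (hv : IsPseudovertex S v) :
    PVEquiv SS v v :=
  ⟨fun f hf => ⟨f, hf, pairRel_refl SS (hv.2.2.1 f hf)⟩,
    fun f hf => ⟨f, hf, pairRel_refl SS (hv.2.2.1 f hf)⟩⟩

theorem pvEquiv_symm (SS : SStructure S) {v w : Set (PartialBij X)} (h : PVEquiv SS v w) :
    PVEquiv SS w v :=
  ⟨fun g hg => let ⟨f, hf, r⟩ := h.2 g hg; ⟨f, hf, pairRel_symm SS r⟩,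
    fun f hf => let ⟨g, hg, r⟩ := h.1 f hf; ⟨g, hg, pairRel_symm SS r⟩⟩

theorem pvEquiv_trans (SS : SStructure S) {u v w : Set (PartialBij X)} (h : PVEquiv SS u v)
    (h' : PVEquiv SS v w) : PVEquiv SS u w := by
  constructor
  · intro f hf
    obtain ⟨g, hg, r⟩ := h.1 f hf
    obtain ⟨k, hk, r'⟩ := h'.1 g hg
    exact ⟨k, hk, pairRel_trans SS r r'⟩
  · intro k hk
    obtain ⟨g, hg, r'⟩ := h'.2 k hk
    obtain ⟨f, hf, r⟩ := h.2 g hg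
    exact ⟨f, hf, pairRel_trans SS r r'⟩

theorem pvEquiv_ncard (SS : SStructure S) {v w : Set (PartialBij X)} (hv : IsPseudovertex S v)
    (hw : IsPseudovertex S w) (h : PVEquiv SS v w) : v.ncard = w.ncard := by
  have iv : Set.InjOn imgSet v := fun f hf g hg e => hv.eq_of_img_eq hf hg e
  have iw : Set.InjOn imgSet w := fun f hf g hg e => hw.eq_of_img_eq hf hg e
  rw [← Set.ncard_image_of_injOn iv, ← Set.ncard_image_of_injOn iw]
  congr 1
  ext A
  constructor
  · rintro ⟨f, hf, rfl⟩
    obtain ⟨g, hg, r⟩ := h.1 f hf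
    exact ⟨g, hg, (pairRel_img SS r).symm⟩
  · rintro ⟨g, hg, rfl⟩
    obtain ⟨f, hf, r⟩ := h.2 g hg
    exact ⟨f, hf, pairRel_img SS r⟩

/-- Facts about a single piece of an expansion. -/
theorem piece_isSPair (hcomp : ∀ f ∈ S, ∀ g ∈ S, PartialBij.comp g f ∈ S)
    (hinv : ∀ f ∈ S, PartialBij.inv f ∈ S) {f h : PartialBij X} (hf : IsSPair S f)
    (hS : h ∈ S) (him : h.imgSet = f.domSet) {E : Set X} (hE : IsDomain S E)
    (hne : E.Nonempty) (hsub : E ⊆ h.domSet) :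
    IsSPair S ((comp f h).restrict E) ∧ ((comp f h).restrict E).domSet = E := by
  have hdom : ((comp f h).restrict E).domSet = E := by
    ext x
    constructor
    · rintro ⟨y, hx, _⟩
      exact hx
    · intro hx
      obtain ⟨z, hz⟩ := hsub hx
      have : z ∈ f.domSet := by
        rw [← him]
        exact ⟨x, hz⟩
      obtain ⟨y, hy⟩ := this
      exact ⟨y, hx, z, hz, hy⟩
  refine ⟨⟨by rwa [hdom], by rwa [hdom], ?_⟩, hdom⟩
  obtain ⟨m, t, htS, hd, hi, hU, hrel⟩ := hf.2.2
  have hrel' : ∀ x y, ((comp f h).restrict E).rel x y ↔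
      ∃ i, (comp (t i) (comp h (idOn E))).rel x y := by
    intro x y
    constructor
    · rintro ⟨hx, z, hz, hy⟩
      obtain ⟨i, hi⟩ := (hrel _ _).1 hy
      exact ⟨i, z, ⟨x, ⟨hx, rfl⟩, hz⟩, hi⟩
    · rintro ⟨i, z, ⟨x', ⟨hx, rfl⟩, hz⟩, hi⟩
      exact ⟨hx, z, hz, (hrel _ _).2 ⟨i, hi⟩⟩
  refine ⟨m, fun i => comp (t i) (comp h (idOn E)), ?_, ?_, ?_, ?_, hrel'⟩
  · intro i
    exact hcomp _ (hcomp _ (idOn_mem hcomp hinv hE) _ hS) _ (htS i)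
  · intro i j hij
    rw [Set.eq_empty_iff_forall_notMem]
    rintro x ⟨⟨y, z, hz, hy⟩, ⟨y', z', hz', hy'⟩⟩
    cases (comp h (idOn E)).functional hz hz'
    exact Set.eq_empty_iff_forall_notMem.1 (hd i j hij) z ⟨⟨y, hy⟩, ⟨y', hy'⟩⟩
  · intro i j hij
    rw [Set.eq_empty_iff_forall_notMem]
    rintro y ⟨⟨x, z, hz, hy⟩, ⟨x', z', hz', hy'⟩⟩
    exact Set.eq_empty_iff_forall_notMem.1 (hi i j hij) y ⟨⟨z, hy⟩, ⟨z', hy'⟩⟩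
  · ext x
    simp only [Set.mem_iUnion]
    constructor
    · rintro ⟨i, y, hy⟩
      exact ⟨y, (hrel' _ _).2 ⟨i, hy⟩⟩
    · rintro ⟨y, hy⟩
      obtain ⟨i, hi⟩ := (hrel' _ _).1 hy
      exact ⟨i, y, hi⟩

theorem piece_img_subset {f h : PartialBij X} {E : Set X} :
    ((comp f h).restrict E).imgSet ⊆ f.imgSet := by
  rintro y ⟨x, _, z, _, hz⟩
  exact ⟨z, hz⟩

/-- An expansion of a pseudovertex is a pseudovertex with the same image and more elements. -/
theorem expansion_spec (hcomp : ∀ f ∈ S, ∀ g ∈ S, PartialBij.comp g f ∈ S)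
    (hinv : ∀ f ∈ S, PartialBij.inv f ∈ S) (SS : SStructure S) {v v' : Set (PartialBij X)}
    (hv : IsPseudovertex S v) (hx : Expansion SS v v') :
    IsPseudovertex S v' ∧ PVImage v' = PVImage v ∧ v.ncard < v'.ncard := by
  obtain ⟨f, hfv, Dh, h, Pt, hh, hPt, ⟨P, hP, Q, hQ, hPQ⟩, rfl⟩ := hx
  obtain ⟨hS, rfl, him⟩ := SS.str_mem _ _ _ hh
  have hf := hv.2.2.1 f hfv
  have hDne : h.domSet.Nonempty := by
    obtain ⟨z, hz⟩ := hf.2.1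
    rw [← him] at hz
    obtain ⟨x, hx⟩ := hz
    exact ⟨x, z, hx⟩
  obtain ⟨hfin, ⟨hem, hUn, hdis⟩, hdomP⟩ := SS.pat_partition _ ⟨h, hS, rfl⟩ hDne Pt hPt
  have hpiece : ∀ E ∈ Pt, IsSPair S ((comp f h).restrict E) ∧
      ((comp f h).restrict E).domSet = E := by
    intro E hE
    refine piece_isSPair hcomp hinv hf hS him (hdomP E hE) ?_ ?_
    · rw [Set.nonempty_iff_ne_empty]
      rintro rfl
      exact hem hE
    · rw [← hUn]
      exact Set.subset_sUnion_of_mem hE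
  have hset : {g | ∃ E ∈ Pt, g = (comp f h).restrict E} =
      (fun E => (comp f h).restrict E) '' Pt := by
    ext g
    constructor
    · rintro ⟨E, hE, rfl⟩
      exact ⟨E, hE, rfl⟩
    · rintro ⟨E, hE, rfl⟩
      exact ⟨E, hE, rfl⟩
  have hfin' : ((v \ {f}) ∪ {g | ∃ E ∈ Pt, g = (comp f h).restrict E}).Finite := by
    rw [hset]
    exact (hv.1.subset Set.diff_subset).union (hfin.image _)
  have hsep : ∀ g ∈ v, g ≠ f → ∀ E, g.imgSet ∩ ((comp f h).restrict E).imgSet = ∅ := by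
    intro g hg hgf E
    rw [Set.eq_empty_iff_forall_notMem]
    rintro y ⟨h1, h2⟩
    exact hgf (hv.eq_of_img hg hfv h1 (piece_img_subset h2))
  refine ⟨⟨hfin', ⟨_, Or.inr ⟨P, hP, rfl⟩⟩, ?_, ?_⟩, ?_, ?_⟩
  · rintro g (⟨hg, _⟩ | ⟨E, hE, rfl⟩)
    · exact hv.2.2.1 g hg
    · exact (hpiece E hE).1
  · rintro g (⟨hg, hgf⟩ | ⟨E, hE, rfl⟩) k (⟨hk, hkf⟩ | ⟨F, hF, rfl⟩) hne
    · exact hv.2.2.2 g hg k hk hne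
    · exact hsep g hg hgf F
    · rw [Set.inter_comm]
      exact hsep k hk hkf E
    · rw [Set.eq_empty_iff_forall_notMem]
      rintro y ⟨⟨x, hx, hr⟩, ⟨x', hx', hr'⟩⟩
      cases (comp f h).injective hr hr'
      have hEF : E ≠ F := by
        rintro rfl
        exact hne rfl
      exact Set.eq_empty_iff_forall_notMem.1 (hdis E hE F hF hEF) x ⟨hx, hx'⟩
  · ext y
    simp only [PVImage, Set.mem_iUnion]
    constructor
    · rintro ⟨g, (⟨hg, _⟩ | ⟨E, hE, rfl⟩), hy⟩
      · exact ⟨g, hg, hy⟩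
      · exact ⟨f, hfv, piece_img_subset hy⟩
    · rintro ⟨g, hg, hy⟩
      by_cases hgf : g = f
      · subst hgf
        obtain ⟨z, hz⟩ := hy
        have hzi : z ∈ h.imgSet := by
          rw [him]
          exact ⟨y, hz⟩
        obtain ⟨x, hx⟩ := hzi
        have hxD : x ∈ ⋃₀ Pt := by
          rw [hUn]
          exact ⟨z, hx⟩
        obtain ⟨E, hE, hxE⟩ := hxD
        exact ⟨_, Or.inr ⟨E, hE, rfl⟩, x, hxE, z, hx, hz⟩
      · exact ⟨g, Or.inl ⟨hg, hgf⟩, hy⟩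
  · have hnot : ∀ E ∈ Pt, (comp f h).restrict E ∉ v \ {f} := by
      rintro E hE ⟨h1, h2⟩
      obtain ⟨y, hy⟩ := (hpiece E hE).1.img_nonempty
      exact Set.eq_empty_iff_forall_notMem.1 (hsep _ h1 h2 E) y ⟨hy, hy⟩
    have hne : (comp f h).restrict P ≠ (comp f h).restrict Q := by
      intro e
      apply hPQ
      rw [← (hpiece P hP).2, e, (hpiece Q hQ).2]
    have hvf : (v \ {f}).Finite := hv.1.subset Set.diff_subset
    have c1 : (v \ {f}).ncard + 1 = v.ncard := Set.ncard_diff_singleton_add_one hfv hv.1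
    have c2 : (insert ((comp f h).restrict Q) (v \ {f})).ncard = (v \ {f}).ncard + 1 :=
      Set.ncard_insert_of_notMem (hnot Q hQ) hvf
    have c3 : (insert ((comp f h).restrict P)
        (insert ((comp f h).restrict Q) (v \ {f}))).ncard =
        (insert ((comp f h).restrict Q) (v \ {f})).ncard + 1 := by
      refine Set.ncard_insert_of_notMem ?_ (hvf.insert _)
      rintro (e | e)
      · exact hne e
      · exact hnot P hP e
    have c4 := Set.ncard_le_ncard (s := insert ((comp f h).restrict P)
        (insert ((comp f h).restrict Q) (v \ {f}))) ?_ hfin'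
    · omega
    · rintro g (rfl | rfl | hg)
      · exact Or.inr ⟨P, hP, rfl⟩
      · exact Or.inr ⟨Q, hQ, rfl⟩
      · exact Or.inl hg

theorem expansion_lift (hcomp : ∀ f ∈ S, ∀ g ∈ S, PartialBij.comp g f ∈ S)
    (hinv : ∀ f ∈ S, PartialBij.inv f ∈ S) (SS : SStructure S) {v vh v' : Set (PartialBij X)}
    (hv : IsPseudovertex S v) (hvh : IsPseudovertex S vh) (he : PVEquiv SS v vh)
    (hx : Expansion SS v v') : ∃ vh', Expansion SS vh vh' ∧ PVEquiv SS v' vh' := by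
  have hv' := (expansion_spec hcomp hinv SS hv hx).1
  obtain ⟨f, hfv, Dh, h, Pt, hh, hPt, hnt, rfl⟩ := hx
  obtain ⟨g, hg, hr⟩ := he.1 f hfv
  have himg := pairRel_img SS hr
  obtain ⟨k, hk, e⟩ := id hr
  have e2 : comp g (comp k h) = comp f h := by
    rw [← comp_assoc', ← e]
  refine ⟨_, ⟨g, hg, Dh, comp k h, Pt, SS.str_comp _ _ _ _ hh _ hk, hPt, hnt, rfl⟩, ?_⟩
  rw [e2]
  constructor
  · rintro a (⟨ha, haf⟩ | ha)
    · obtain ⟨b, hb, r⟩ := he.1 a ha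
      refine ⟨b, Or.inl ⟨hb, ?_⟩, r⟩
      rintro rfl
      exact haf (hv.eq_of_img_eq ha hfv ((pairRel_img SS r).trans himg.symm))
    · exact ⟨a, Or.inr ha, pairRel_refl SS (hv'.2.2.1 a (Or.inr ha))⟩
  · rintro b (⟨hb, hbg⟩ | hb)
    · obtain ⟨a, ha, r⟩ := he.2 b hb
      refine ⟨a, Or.inl ⟨ha, ?_⟩, r⟩
      rintro rfl
      exact hbg (hvh.eq_of_img_eq hb hg ((pairRel_img SS r).symm.trans himg))
    · exact ⟨b, Or.inr hb, pairRel_refl SS (hv'.2.2.1 b (Or.inr hb))⟩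

theorem chain_spec (hcomp : ∀ f ∈ S, ∀ g ∈ S, PartialBij.comp g f ∈ S)
    (hinv : ∀ f ∈ S, PartialBij.inv f ∈ S) (SS : SStructure S) {v w : Set (PartialBij X)}
    (hv : IsPseudovertex S v) (hx : Relation.ReflTransGen (Expansion SS) v w) :
    IsPseudovertex S w ∧ (v = w ∨ v.ncard < w.ncard) := by
  induction hx with
  | refl => exact ⟨hv, Or.inl rfl⟩
  | tail _ hs ih =>
    obtain ⟨h1, -, h2⟩ := expansion_spec hcomp hinv SS ih.1 hs
    refine ⟨h1, Or.inr ?_⟩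
    rcases ih.2 with rfl | h3
    · exact h2
    · exact h3.trans h2

theorem chain_lift (hcomp : ∀ f ∈ S, ∀ g ∈ S, PartialBij.comp g f ∈ S)
    (hinv : ∀ f ∈ S, PartialBij.inv f ∈ S) (SS : SStructure S) {v vh w : Set (PartialBij X)}
    (hv : IsPseudovertex S v) (hvh : IsPseudovertex S vh) (he : PVEquiv SS v vh)
    (hx : Relation.ReflTransGen (Expansion SS) v w) :
    ∃ wh, Relation.ReflTransGen (Expansion SS) vh wh ∧ PVEquiv SS w wh := by
  induction hx with
  | refl => exact ⟨vh, .refl, he⟩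
  | tail hc hs ih =>
    obtain ⟨wh, hwh, e⟩ := ih
    obtain ⟨wh', hs', e'⟩ := expansion_lift hcomp hinv SS (chain_spec hcomp hinv SS hv hc).1
      (chain_spec hcomp hinv SS hvh hwh).1 e hs
    exact ⟨wh', hwh.tail hs', e'⟩

end helpers

/-- expansions of pseudovertices are pseudovertices with the same
image; expansion is well defined on equivalence classes of pseudovertices; and
the relation `≤` generated by expansion is a partial order on pseudovertices
(reflexive, transitive, and antisymmetric up to equality of sets of classes). -/
theorem statement10 {X : Type*} (S : Set (PartialBij X))
    (hcomp : ∀ f ∈ S, ∀ g ∈ S, PartialBij.comp g f ∈ S)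
    (hinv : ∀ f ∈ S, PartialBij.inv f ∈ S)
    (SS : SStructure S) :
    (∀ v v' : Set (PartialBij X), IsPseudovertex S v → Expansion SS v v' →
      IsPseudovertex S v' ∧ PVImage v' = PVImage v) ∧
    (∀ v vh v' : Set (PartialBij X), IsPseudovertex S v → IsPseudovertex S vh →
      PVEquiv SS v vh → Expansion SS v v' →
      ∃ vh' : Set (PartialBij X), Expansion SS vh vh' ∧ PVEquiv SS v' vh') ∧
    (∀ v : Set (PartialBij X), IsPseudovertex S v → PVLE SS v v) ∧
    (∀ u v w : Set (PartialBij X), IsPseudovertex S u → IsPseudovertex S v →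
      IsPseudovertex S w → PVLE SS u v → PVLE SS v w → PVLE SS u w) ∧
    (∀ v w : Set (PartialBij X), IsPseudovertex S v → IsPseudovertex S w →
      PVLE SS v w → PVLE SS w v → PVEquiv SS v w) := by
  refine ⟨?_, ?_, ?_, ?_, ?_⟩
  · intro v v' hv hx
    obtain ⟨h1, h2, -⟩ := expansion_spec hcomp hinv SS hv hx
    exact ⟨h1, h2⟩
  · intro v vh v' hv hvh he hx
    exact expansion_lift hcomp hinv SS hv hvh he hx
  · intro v hv
    exact ⟨v, .refl, pvEquiv_refl SS hv⟩
  · rintro u v w hu hv hw ⟨v', hc, e⟩ ⟨w', hc', e'⟩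
    obtain ⟨w'', hc'', e''⟩ := chain_lift hcomp hinv SS hv
      (chain_spec hcomp hinv SS hu hc).1 (pvEquiv_symm SS e) hc'
    exact ⟨w'', hc.trans hc'', pvEquiv_trans SS (pvEquiv_symm SS e'') e'⟩
  · rintro v w hv hw ⟨w', hc, e⟩ ⟨v', hc', e'⟩
    obtain ⟨hw', h1⟩ := chain_spec hcomp hinv SS hv hc
    obtain ⟨hv', h2⟩ := chain_spec hcomp hinv SS hw hc'
    have c1 := pvEquiv_ncard SS hw' hw e
    have c2 := pvEquiv_ncard SS hv' hv e'
    rcases h1 with rfl | h1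
    · exact e
    · rcases h2 with rfl | h2 <;> omega
end GTLD
end

section
/- Fix an S-structure (𝕊, ℙ), and let v₁ and v₂ be pseudovertices with v₁ ≤ v₂. Then: (1) for every pseudovertex v₁' ⊆ v₁ there is a unique pseudovertex v₂' ⊆ v₂ such that im(v₁') = im(v₂'); and (2) whenever v₁' ⊆ v₁ and v₂' ⊆ v₂ are pseudovertices with im(v₁') = im(v₂'), one has v₁' ≤ v₂'. -/
set_option autoImplicit false

namespace GTLD

theorem aux_expansion {X : Type*} {S : Set (PartialBij X)} (SS : SStructure S)
    {w u : Set (PartialBij X)} (hw : ∀ f ∈ w, f.domSet.Nonempty) (h : Expansion SS w u) :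
    (∀ f ∈ u, f.domSet.Nonempty) ∧
    ∀ w' ⊆ w, ∃ u' ⊆ u, Relation.ReflTransGen (Expansion SS) w' u' ∧
      PVImage u' = PVImage w' := by
  obtain ⟨f, hf, Dh, h, Pt, hh, hPt, hne, rfl⟩ := h
  obtain ⟨hS, hdom, himg⟩ := SS.str_mem _ _ _ hh
  have hDh : Dh.Nonempty := by
    obtain ⟨x, hx⟩ := hw f hf
    rw [← himg] at hx
    obtain ⟨z, hz⟩ := hx
    exact ⟨z, hdom ▸ ⟨x, hz⟩⟩
  obtain ⟨-, ⟨hem, hun, -⟩, -⟩ := SS.pat_partition Dh ⟨h, hS, hdom⟩ hDh Pt hPt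
  refine ⟨?_, ?_⟩
  · rintro g (hg | ⟨E, hE, rfl⟩)
    · exact hw g hg.1
    · have hEne : E.Nonempty := by
        rw [Set.nonempty_iff_ne_empty]
        rintro rfl
        exact hem hE
      obtain ⟨z, hz⟩ := hEne
      have hzD : z ∈ h.domSet := by
        rw [hdom, ← hun]
        exact ⟨E, hE, hz⟩
      obtain ⟨x, hx⟩ := hzD
      have hxf : x ∈ f.domSet := himg ▸ ⟨z, hx⟩
      obtain ⟨y, hy⟩ := hxf
      exact ⟨z, y, hz, x, hx, hy⟩
  · intro w' hw'
    by_cases hfw : f ∈ w'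
    · refine ⟨(w' \ {f}) ∪ {g | ∃ E ∈ Pt, g = (PartialBij.comp f h).restrict E}, ?_,
        Relation.ReflTransGen.single ⟨f, hfw, Dh, h, Pt, hh, hPt, hne, rfl⟩, ?_⟩
      · rintro g (hg | hg)
        · exact Or.inl ⟨hw' hg.1, hg.2⟩
        · exact Or.inr hg
      · ext y
        simp only [PVImage, Set.mem_iUnion, exists_prop]
        constructor
        · rintro ⟨g, hg | ⟨E, hE, rfl⟩, hy⟩
          · exact ⟨g, hg.1, hy⟩
          · obtain ⟨z, -, x, -, hxy⟩ := hy
            exact ⟨f, hfw, x, hxy⟩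
        · rintro ⟨g, hg, hy⟩
          by_cases hgf : g = f
          · subst hgf
            obtain ⟨x, hxy⟩ := hy
            have hx : x ∈ h.imgSet := himg ▸ ⟨y, hxy⟩
            obtain ⟨z, hz⟩ := hx
            have hzD : z ∈ ⋃₀ Pt := by
              rw [hun, ← hdom]
              exact ⟨x, hz⟩
            obtain ⟨E, hE, hzE⟩ := hzD
            exact ⟨_, Or.inr ⟨E, hE, rfl⟩, z, hzE, x, hz, hxy⟩
          · exact ⟨g, Or.inl ⟨hg, hgf⟩, hy⟩
    · refine ⟨w', ?_, Relation.ReflTransGen.refl, rfl⟩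
      intro g hg
      refine Or.inl ⟨hw' hg, ?_⟩
      rintro rfl
      exact hfw hg

theorem aux_chain {X : Type*} {S : Set (PartialBij X)} (SS : SStructure S)
    {v w : Set (PartialBij X)} (hv : ∀ f ∈ v, f.domSet.Nonempty)
    (h : Relation.ReflTransGen (Expansion SS) v w) :
    (∀ f ∈ w, f.domSet.Nonempty) ∧
    ∀ v' ⊆ v, ∃ w' ⊆ w, Relation.ReflTransGen (Expansion SS) v' w' ∧
      PVImage w' = PVImage v' := by
  induction h with
  | refl => exact ⟨hv, fun v' hv' => ⟨v', hv', Relation.ReflTransGen.refl, rfl⟩⟩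
  | tail _ hs ih =>
    obtain ⟨h1, h2⟩ := aux_expansion SS ih.1 hs
    refine ⟨h1, fun v' hv' => ?_⟩
    obtain ⟨w', hw', hr, hi⟩ := ih.2 v' hv'
    obtain ⟨u', hu', hr', hi'⟩ := h2 w' hw'
    exact ⟨u', hu', hr.trans hr', hi'.trans hi⟩

theorem aux_img {X : Type*} {S : Set (PartialBij X)} (SS : SStructure S)
    {f g : PartialBij X} (h : PairRel SS f g) : f.imgSet = g.imgSet := by
  obtain ⟨h, hh, he⟩ := h
  obtain ⟨-, -, himg⟩ := SS.str_mem _ _ _ hh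
  rw [he]
  ext y
  constructor
  · rintro ⟨z, x, -, hx⟩
    exact ⟨x, hx⟩
  · rintro ⟨x, hx⟩
    have hxi : x ∈ h.imgSet := himg ▸ ⟨y, hx⟩
    obtain ⟨z, hz⟩ := hxi
    exact ⟨z, x, hz, hx⟩

theorem aux_sub {X : Type*} {S : Set (PartialBij X)} {v a b : Set (PartialBij X)}
    (hv : IsPseudovertex S v) (ha : a ⊆ v) (hb : b ⊆ v)
    (h : PVImage a ⊆ PVImage b) : a ⊆ b := by
  intro f hf
  obtain ⟨x, y, hxy⟩ := (hv.2.2.1 f (ha hf)).2.1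
  have hy : y ∈ PVImage a := by
    simp only [PVImage, Set.mem_iUnion, exists_prop]
    exact ⟨f, hf, x, hxy⟩
  have hy' := h hy
  simp only [PVImage, Set.mem_iUnion, exists_prop] at hy'
  obtain ⟨g, hg, hyg⟩ := hy'
  by_cases hfg : f = g
  · rwa [hfg]
  · have := hv.2.2.2 f (ha hf) g (hb hg) hfg
    have hmem : y ∈ f.imgSet ∩ g.imgSet := ⟨⟨x, hxy⟩, hyg⟩
    rw [this] at hmem
    exact hmem.elim

theorem aux_main {X : Type*} {S : Set (PartialBij X)} (SS : SStructure S)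
    {v₁ v₂ : Set (PartialBij X)} (h₁ : IsPseudovertex S v₁)
    (hle : PVLE SS v₁ v₂) {v₁' : Set (PartialBij X)} (hs : v₁' ⊆ v₁) :
    ∃ v₂' ⊆ v₂, PVImage v₂' = PVImage v₁' ∧ PVLE SS v₁' v₂' := by
  obtain ⟨w, hr, hE1, hE2⟩ := hle
  obtain ⟨w', hw', hr', hi⟩ := (aux_chain SS (fun f hf => (h₁.2.2.1 f hf).2.1) hr).2 v₁' hs
  have hEq : PVEquiv SS w' {g | g ∈ v₂ ∧ ∃ f ∈ w', PairRel SS f g} := by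
    refine ⟨fun f hf => ?_, fun g hg => hg.2⟩
    obtain ⟨g, hg, hfg⟩ := hE1 f (hw' hf)
    exact ⟨g, ⟨hg, f, hf, hfg⟩, hfg⟩
  refine ⟨{g | g ∈ v₂ ∧ ∃ f ∈ w', PairRel SS f g}, fun g hg => hg.1, ?_, w', hr', hEq⟩
  rw [← hi]
  ext y
  simp only [PVImage, Set.mem_iUnion, exists_prop]
  constructor
  · rintro ⟨g, ⟨-, f, hf, hfg⟩, hy⟩
    exact ⟨f, hf, aux_img SS hfg ▸ hy⟩
  · rintro ⟨f, hf, hy⟩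
    obtain ⟨g, hg, hfg⟩ := hEq.1 f hf
    exact ⟨g, hg, aux_img SS hfg ▸ hy⟩

/-- the partial order is locally determined: if `v₁ ≤ v₂`, then every
pseudovertex `v₁' ⊆ v₁` has a unique counterpart `v₂' ⊆ v₂` with the same image,
and any two such counterparts satisfy `v₁' ≤ v₂'`. -/
theorem statement11 {X : Type*} (S : Set (PartialBij X))
    (hcomp : ∀ f ∈ S, ∀ g ∈ S, PartialBij.comp g f ∈ S)
    (hinv : ∀ f ∈ S, PartialBij.inv f ∈ S)
    (SS : SStructure S)
    (v₁ v₂ : Set (PartialBij X))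
    (h₁ : IsPseudovertex S v₁) (h₂ : IsPseudovertex S v₂)
    (hle : PVLE SS v₁ v₂) :
    (∀ v₁' : Set (PartialBij X), v₁' ⊆ v₁ → IsPseudovertex S v₁' →
      ∃! v₂' : Set (PartialBij X),
        v₂' ⊆ v₂ ∧ IsPseudovertex S v₂' ∧ PVImage v₂' = PVImage v₁') ∧
    (∀ v₁' v₂' : Set (PartialBij X), v₁' ⊆ v₁ → v₂' ⊆ v₂ →
      IsPseudovertex S v₁' → IsPseudovertex S v₂' →
      PVImage v₁' = PVImage v₂' → PVLE SS v₁' v₂') := by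
  refine ⟨fun v₁' hs hv => ?_, fun v₁' v₂' hs1 hs2 _ _ hi => ?_⟩
  · obtain ⟨v₂', hs2, hi, -⟩ := aux_main SS h₁ hle hs
    refine ⟨v₂', ⟨hs2, ⟨h₂.1.subset hs2, ?_, fun f hf => h₂.2.2.1 f (hs2 hf),
      fun f hf g hg => h₂.2.2.2 f (hs2 hf) g (hs2 hg)⟩, hi⟩, ?_⟩
    · obtain ⟨f, hf⟩ := hv.2.1
      obtain ⟨x, y, hxy⟩ := (hv.2.2.1 f hf).2.1
      have hy : y ∈ PVImage v₂' := by
        rw [hi]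
        simp only [PVImage, Set.mem_iUnion, exists_prop]
        exact ⟨f, hf, x, hxy⟩
      simp only [PVImage, Set.mem_iUnion, exists_prop] at hy
      obtain ⟨g, hg, -⟩ := hy
      exact ⟨g, hg⟩
    · rintro u ⟨hu, -, hui⟩
      have he : PVImage u = PVImage v₂' := hui.trans hi.symm
      exact (aux_sub h₂ hu hs2 he.subset).antisymm (aux_sub h₂ hs2 hu he.symm.subset)
  · obtain ⟨u, hu, hui, hl⟩ := aux_main SS h₁ hle hs1
    have he : PVImage u = PVImage v₂' := hui.trans hi
    have : u = v₂' :=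
      (aux_sub h₂ hu hs2 he.subset).antisymm (aux_sub h₂ hs2 hu he.symm.subset)
    exact this ▸ hl

end GTLD
end
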